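/- If M is a locally compact sober MT-algebra, then the atom space at(M) is a locally compact sober space: for every u ∈ O(M) and every atom x ∈ η(u) there exist v ∈ O(M) and a compact saturated subset K of at(M) with x ∈ η(v) ⊆ K ⊆ η(u). -/

import Mathlib

/-- An MT-algebra: a complete Boolean algebra with an interior operator. -/
structure MTAlg (M : Type*) [CompleteBooleanAlgebra M] where
  box : M → M
  box_top : box ⊤ = ⊤
  box_inf : ∀ a b : M, box (a ⊓ b) = box a ⊓ box b
  box_le : ∀ a : M, box a ≤ a
  box_idem : ∀ a : M, box a ≤ box (box a)

namespace MTAlg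

variable {M : Type*} [CompleteBooleanAlgebra M] (T : MTAlg M)

/-- The closure (dual) operator. -/
def dia (a : M) : M := (T.box aᶜ)ᶜ

/-- Open elements. -/
def IsOpenElem (a : M) : Prop := T.box a = a

/-- Closed elements. -/
def IsClosedElem (a : M) : Prop := T.dia a = a

/-- Saturated elements: meets of open elements. -/
def IsSaturatedElem (a : M) : Prop :=
  ∃ S : Set M, (∀ s ∈ S, T.IsOpenElem s) ∧ a = sInf S

/-- Weakly locally closed elements: meets of a saturated and a closed element. -/
def IsWLC (a : M) : Prop :=
  ∃ s c : M, T.IsSaturatedElem s ∧ T.IsClosedElem c ∧ a = s ⊓ c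

/-- T0-algebras: every element is a join of weakly locally closed elements. -/
def IsT0 : Prop :=
  ∀ a : M, ∃ S : Set M, (∀ b ∈ S, T.IsWLC b) ∧ a = sSup S

/-- T1-algebras: every element is a join of closed elements. -/
def IsT1 : Prop :=
  ∀ a : M, ∃ S : Set M, (∀ b ∈ S, T.IsClosedElem b) ∧ a = sSup S

/-- Join-irreducible elements of the lattice of closed elements. -/
def JoinIrredClosed (p : M) : Prop :=
  T.IsClosedElem p ∧ p ≠ ⊥ ∧
    ∀ a b : M, T.IsClosedElem a → T.IsClosedElem b → p = a ⊔ b → p = a ∨ p = b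

/-- Sober MT-algebras. -/
def Sober : Prop :=
  T.IsT0 ∧ ∀ p : M, T.JoinIrredClosed p → ∃ x : M, IsAtom x ∧ p = T.dia x

/-- Filters of the underlying lattice. -/
def IsFilter (F : Set M) : Prop :=
  ⊤ ∈ F ∧ (∀ a b : M, a ∈ F → a ≤ b → b ∈ F) ∧ (∀ a b : M, a ∈ F → b ∈ F → a ⊓ b ∈ F)

/-- Open filters. -/
def IsOpenFilter (F : Set M) : Prop :=
  IsFilter F ∧ ∀ a ∈ F, T.box a ∈ F

/-- Scott-open filters. -/
def IsScottOpenFilter (F : Set M) : Prop :=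
  T.IsOpenFilter F ∧
    ∀ S : Set M, (∀ s ∈ S, T.IsOpenElem s) → S.Nonempty → DirectedOn (· ≤ ·) S →
      sSup S ∈ F → ∃ s ∈ S, s ∈ F

/-- Compact elements. -/
def IsCompactElem (a : M) : Prop :=
  ∀ S : Set M, (∀ s ∈ S, T.IsOpenElem s) → a ≤ sSup S →
    ∃ t ⊆ S, t.Finite ∧ a ≤ sSup t

/-- The relation `a ◁ b`: there is a compact element between `a` and `b`. -/
def Triangle (a b : M) : Prop := ∃ k : M, T.IsCompactElem k ∧ a ≤ k ∧ k ≤ b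

/-- Locally compact MT-algebras. -/
def LocallyCompact : Prop :=
  ∀ u : M, T.IsOpenElem u → u = sSup {v : M | T.IsOpenElem v ∧ T.Triangle v u}

/-- The way-below relation in the frame of open elements. -/
def WayBelowOpen (a b : M) : Prop :=
  ∀ S : Set M, (∀ s ∈ S, T.IsOpenElem s) → b ≤ sSup S →
    ∃ t ⊆ S, t.Finite ∧ a ≤ sSup t

/-- Elements approximated from above by regular closed elements. -/
def GC (a : M) : Prop :=
  a = sInf {b : M | ∃ c : M, a ≤ T.box c ∧ b = T.dia (T.box c)}

/-- Hausdorff MT-algebras. -/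
def IsHausdorff : Prop :=
  ∀ a : M, ∃ S : Set M, (∀ b ∈ S, T.GC b) ∧ a = sSup S

/-- Regular MT-algebras. -/
def IsRegular : Prop :=
  T.IsT1 ∧ ∀ a : M, T.IsOpenElem a →
    a = sSup {b : M | T.IsOpenElem b ∧ T.dia b ≤ a}

end MTAlg

/-- The atom space of a complete Boolean algebra. -/
abbrev AtomSpace (M : Type*) [CompleteBooleanAlgebra M] : Type _ := {x : M // IsAtom x}

/-- The set of atoms below an element. -/
def eta {M : Type*} [CompleteBooleanAlgebra M] (a : M) : Set (AtomSpace M) :=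
  {x : AtomSpace M | x.1 ≤ a}

namespace MTAlg

variable {M : Type*} [CompleteBooleanAlgebra M] (T : MTAlg M)

/-- The topology on the atom space, generated by the images of open elements. -/
def atTop : TopologicalSpace (AtomSpace M) :=
  TopologicalSpace.generateFrom {U : Set (AtomSpace M) | ∃ u : M, T.IsOpenElem u ∧ U = eta u}

end MTAlg

theorem IsAtom.not_le_iff_le_compl {M : Type*} [BooleanAlgebra M] {x a : M} (hx : IsAtom x) :
    ¬ x ≤ a ↔ x ≤ aᶜ := by
  rw [hx.not_le_iff_disjoint, le_compl_iff_disjoint_right]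

namespace MTAlg

variable {M : Type*} [CompleteBooleanAlgebra M] {T : MTAlg M}

open scoped Topology

theorem box_mono {a b : M} (h : a ≤ b) : T.box a ≤ T.box b := by
  rw [← inf_eq_left.2 h, T.box_inf]
  exact inf_le_right

theorem isOpenElem_of_le {a : M} (h : a ≤ T.box a) : T.IsOpenElem a :=
  (T.box_le a).antisymm h

theorem isOpenElem_sSup {S : Set M} (hS : ∀ s ∈ S, T.IsOpenElem s) : T.IsOpenElem (sSup S) :=
  isOpenElem_of_le <| sSup_le fun s hs => (hS s hs).ge.trans (box_mono (le_sSup hs))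

theorem isOpenElem_top : T.IsOpenElem ⊤ := T.box_top

theorem IsOpenElem.inf {a b : M} (ha : T.IsOpenElem a) (hb : T.IsOpenElem b) :
    T.IsOpenElem (a ⊓ b) := by
  rw [IsOpenElem, T.box_inf, ha, hb]

theorem isClosedElem_iff {a : M} : T.IsClosedElem a ↔ T.IsOpenElem aᶜ := by
  rw [IsClosedElem, dia, IsOpenElem, compl_eq_comm, eq_comm]

theorem IsOpenElem.isClosedElem_compl {a : M} (ha : T.IsOpenElem a) : T.IsClosedElem aᶜ := by
  rwa [isClosedElem_iff, compl_compl]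

theorem le_dia (a : M) : a ≤ T.dia a :=
  le_compl_comm.1 (T.box_le aᶜ)

theorem IsOpenElem.dia_le_compl_iff {a w : M} (hw : T.IsOpenElem w) :
    T.dia a ≤ wᶜ ↔ a ≤ wᶜ := by
  refine ⟨(le_dia a).trans, fun h => compl_le_compl ?_⟩
  rw [← show T.box w = w from hw]
  exact box_mono (le_compl_comm.1 h)

/-- An open element meeting the closure of an atom contains the atom. -/
theorem IsOpenElem.le_of_not_dia_le_compl {x w : M} (hw : T.IsOpenElem w) (hx : IsAtom x)
    (h : ¬ T.dia x ≤ wᶜ) : x ≤ w := by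
  rwa [hw.dia_le_compl_iff, ← hx.not_le_iff_le_compl, not_not] at h

theorem isOpen_atTop_iff {U : Set (AtomSpace M)} :
    IsOpen[T.atTop] U ↔ ∃ u : M, T.IsOpenElem u ∧ U = eta u := by
  refine ⟨fun h => ?_, fun h => TopologicalSpace.isOpen_generateFrom_of_mem h⟩
  induction h with
  | basic s hs => exact hs
  | univ => exact ⟨⊤, isOpenElem_top, by ext; simp [eta]⟩
  | inter s t _ _ hs ht =>
    obtain ⟨u, hu, rfl⟩ := hs
    obtain ⟨v, hv, rfl⟩ := ht
    exact ⟨u ⊓ v, hu.inf hv, by ext; simp [eta]⟩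
  | sUnion S _ hS =>
    refine ⟨sSup {u | T.IsOpenElem u ∧ eta u ∈ S}, isOpenElem_sSup fun s hs => hs.1, ?_⟩
    ext x
    simp only [Set.mem_sUnion, eta, Set.mem_ofPred_eq, x.2.le_sSup]
    constructor
    · rintro ⟨s, hs, hx⟩
      obtain ⟨u, hu, rfl⟩ := hS s hs
      exact ⟨u, ⟨hu, hs⟩, hx⟩
    · rintro ⟨u, hu, hx⟩
      exact ⟨_, hu.2, hx⟩

theorem isOpen_eta {u : M} (hu : T.IsOpenElem u) : IsOpen[T.atTop] (eta u) :=
  isOpen_atTop_iff.2 ⟨u, hu, rfl⟩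

theorem isClosed_eta {c : M} (hc : T.IsClosedElem c) : IsClosed[T.atTop] (eta c) := by
  let := T.atTop
  rw [← isOpen_compl_iff]
  convert isOpen_eta (isClosedElem_iff.1 hc)
  ext x
  exact x.2.not_le_iff_le_compl

theorem IsT0.eq_of_forall_le {x y : M} (hT : T.IsT0) (hx : IsAtom x) (hy : IsAtom y)
    (h : ∀ u, T.IsOpenElem u → (x ≤ u ↔ y ≤ u)) : x = y := by
  obtain ⟨S, hS, hxS⟩ := hT x
  obtain ⟨b, hb, hxb⟩ := hx.le_sSup.1 hxS.le
  obtain rfl : x = b := hxb.antisymm (hxS ▸ le_sSup hb)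
  obtain ⟨s, c, ⟨U, hU, rfl⟩, hc, hxsc⟩ := hS x hb
  have hxs : x ≤ sInf U := hxsc ▸ inf_le_left
  have hxc : x ≤ c := hxsc ▸ inf_le_right
  have hyx : y ≤ x := by
    rw [hxsc]
    refine le_inf (le_sInf fun u hu => (h u (hU u hu)).1 (hxs.trans (sInf_le hu))) ?_
    by_contra hyc
    exact hx.not_le_iff_le_compl.2
      ((h _ (isClosedElem_iff.1 hc)).2 (hy.not_le_iff_le_compl.1 hyc)) hxc
  exact (hx.le_iff.1 hyx).elim (fun h => absurd h hy.ne_bot) Eq.symm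

theorem IsT0.t0Space_atTop (hT : T.IsT0) : @T0Space (AtomSpace M) T.atTop := by
  let := T.atTop
  refine ⟨fun x y hxy => Subtype.ext <| hT.eq_of_forall_le x.2 y.2 fun u hu => ?_⟩
  exact inseparable_iff_forall_isOpen.1 hxy _ (isOpen_eta hu)

theorem Sober.quasiSober_atTop (hT : T.Sober) : @QuasiSober (AtomSpace M) T.atTop := by
  let := T.atTop
  refine ⟨fun {Z} hZ hZc => ?_⟩
  let u : M := sSup {v | T.IsOpenElem v ∧ eta v ⊆ Zᶜ}
  have hu : T.IsOpenElem u := isOpenElem_sSup fun s hs => hs.1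
  have le_u {v : M} (hv : T.IsOpenElem v) (hvZ : eta v ⊆ Zᶜ) : v ≤ u := le_sSup ⟨hv, hvZ⟩
  have hZu : Z = eta uᶜ := by
    obtain ⟨v, hv, hvZ⟩ := isOpen_atTop_iff.1 hZc.isOpen_compl
    ext x
    simp only [eta, Set.mem_ofPred_eq, ← x.2.not_le_iff_le_compl]
    constructor
    · intro hxZ hxu
      obtain ⟨w, hw, hxw⟩ := x.2.le_sSup.1 hxu
      exact hw.2 hxw hxZ
    · intro hxu
      by_contra hxZ
      rw [← Set.mem_compl_iff, hvZ] at hxZ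
      exact hxu (le_trans hxZ (le_u hv hvZ.ge))
  have hirr : T.JoinIrredClosed uᶜ := by
    refine ⟨hu.isClosedElem_compl, ?_, fun a b ha hb hab => ?_⟩
    · intro hbot
      obtain ⟨z, hz⟩ := hZ.nonempty
      rw [hZu, hbot] at hz
      exact z.2.ne_bot (le_bot_iff.1 hz)
    · have aux {c : M} (hc : T.IsClosedElem c) (hZc : Z ⊆ eta c) : uᶜ ≤ c := by
        refine compl_le_iff_compl_le.1 (le_u (isClosedElem_iff.1 hc) fun x hx hxZ => ?_)
        exact x.2.not_le_iff_le_compl.2 hx (hZc hxZ)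
      have hcover : Z ⊆ eta a ∪ eta b := by
        intro x hx
        rw [hZu, hab] at hx
        by_contra h
        simp only [Set.mem_union, not_or, eta, Set.mem_ofPred_eq, x.2.not_le_iff_le_compl,
          ← le_inf_iff, ← compl_sup] at h
        exact x.2.not_le_iff_le_compl.2 h hx
      refine (isPreirreducible_iff_isClosed_union_isClosed.1 hZ.isPreirreducible _ _
        (isClosed_eta ha) (isClosed_eta hb) hcover).imp (fun h => ?_) (fun h => ?_)
      · exact (aux ha h).antisymm (hab ▸ le_sup_left)
      · exact (aux hb h).antisymm (hab ▸ le_sup_right)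
  obtain ⟨x, hx, hux⟩ := hT.2 _ hirr
  refine ⟨⟨x, hx⟩, ?_⟩
  rw [isGenericPoint_iff_forall_closed hZc (hZu ▸ hux ▸ le_dia x)]
  intro C hC hxC y hy
  by_contra hyC
  obtain ⟨w, hw, hwC⟩ := isOpen_atTop_iff.1 hC.isOpen_compl
  have hyw : y.1 ≤ w := (hwC ▸ hyC : y ∈ eta w)
  refine (hwC ▸ hw.le_of_not_dia_le_compl hx fun h => ?_ : (⟨x, hx⟩ : AtomSpace M) ∈ Cᶜ) hxC
  rw [hZu, hux] at hy
  exact y.2.not_le_iff_le_compl.2 (le_trans hy h) hyw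

/-- In a sober MT-algebra, a compact element not below an open element `v` is separated from it
by an atom lying in every open element above the compact one. -/
theorem IsCompactElem.exists_isAtom {k v : M} (hk : T.IsCompactElem k) (hT : T.Sober)
    (hv : T.IsOpenElem v) (hkv : ¬ k ≤ v) :
    ∃ x : M, IsAtom x ∧ ¬ x ≤ v ∧ ∀ w, T.IsOpenElem w → k ≤ w → x ≤ w := by
  obtain ⟨p, hvp, hp⟩ := zorn_le_nonempty₀ {w : M | T.IsOpenElem w ∧ ¬ k ≤ w} (by
    intro c hc hchain y hy
    refine ⟨sSup c, ⟨isOpenElem_sSup fun s hs => (hc hs).1, fun hkc => ?_⟩, fun z => le_sSup⟩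
    obtain ⟨t, htc, htf, hkt⟩ := hk c (fun s hs => (hc hs).1) hkc
    obtain rfl | hne := t.eq_empty_or_nonempty
    · exact (hc hy).2 (hkt.trans (by simp))
    · obtain ⟨m, hm⟩ := htf.exists_maximal hne
      refine (hc (htc hm.prop)).2 (hkt.trans (sSup_le fun s hs => ?_))
      exact (hchain.total (htc hs) (htc hm.prop)).elim id (hm.le_of_ge hs)) v ⟨hv, hkv⟩
  have hle {a : M} (ha : T.IsClosedElem a) (hap : a ≤ pᶜ) (hne : pᶜ ≠ a) : k ≤ aᶜ := by
    by_contra h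
    refine hne (le_antisymm ?_ hap)
    exact compl_le_iff_compl_le.1 (hp.le_of_ge ⟨isClosedElem_iff.1 ha, h⟩ (le_compl_comm.1 hap))
  have hirr : T.JoinIrredClosed pᶜ := by
    refine ⟨hp.prop.1.isClosedElem_compl, fun h => hp.prop.2 (by simp [compl_eq_bot.1 h]), ?_⟩
    intro a b ha hb hab
    by_contra! h
    have hka := hle ha (hab ▸ le_sup_left) h.1
    have hkb := hle hb (hab ▸ le_sup_right) h.2
    refine hp.prop.2 ?_
    rw [← compl_compl p, hab, compl_sup]
    exact le_inf hka hkb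
  obtain ⟨x, hx, hpx⟩ := hT.2 _ hirr
  refine ⟨x, hx, fun hxv => hx.not_le_iff_le_compl.2 (hpx ▸ le_dia x) (hxv.trans hvp), ?_⟩
  intro w hw hkw
  refine hw.le_of_not_dia_le_compl hx fun h => hp.prop.2 (hkw.trans ?_)
  rwa [← hpx, compl_le_compl_iff_le] at h

/-- The atoms in the saturation of a compact element form a compact set. -/
theorem IsCompactElem.isCompact_sInter_eta {k : M} (hk : T.IsCompactElem k) (hT : T.Sober) :
    @IsCompact (AtomSpace M) T.atTop (⋂₀ {U | ∃ w, T.IsOpenElem w ∧ k ≤ w ∧ U = eta w}) := by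
  let := T.atTop
  refine isCompact_of_finite_subcover fun {ι} U hU hcover => ?_
  choose w hw hUw using fun i => isOpen_atTop_iff.1 (hU i)
  have hopen : ∀ s ∈ Set.range w, T.IsOpenElem s := Set.forall_mem_range.2 hw
  have hkw : k ≤ sSup (Set.range w) := by
    by_contra h
    obtain ⟨x, hx, hxw, hxk⟩ := hk.exists_isAtom hT (isOpenElem_sSup hopen) h
    have hmem := @hcover ⟨x, hx⟩ (by
      rintro _ ⟨v, hv, hkv, rfl⟩
      exact hxk v hv hkv)
    obtain ⟨i, hi⟩ := Set.mem_iUnion.1 hmem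
    rw [hUw] at hi
    exact hxw (le_trans hi (le_sSup ⟨i, rfl⟩))
  obtain ⟨t, ht, htf, hkt⟩ := hk _ hopen hkw
  obtain ⟨s, rfl⟩ : ∃ s : Finset ι, t = w '' s := by
    obtain ⟨s, -, hs, hst⟩ := (Set.exists_subset_image_finite_and (f := w) (s := Set.univ)
      (p := fun r => t = r)).1 ⟨t, by simpa using ht, htf, rfl⟩
    exact ⟨hs.toFinset, by simpa using hst⟩
  refine ⟨s, fun x hx => ?_⟩
  have hxt : x.1 ≤ sSup (w '' s) :=
    hx _ ⟨_, isOpenElem_sSup fun a ha => hopen a (ht ha), hkt, rfl⟩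
  obtain ⟨_, ⟨i, hi, rfl⟩, hxi⟩ := x.2.le_sSup.1 hxt
  exact Set.mem_biUnion hi (hUw i ▸ hxi)

end MTAlg

/-- If `M` is a locally compact sober MT-algebra, then the atom space is a locally
compact sober space: it is T0, quasi-sober, and every atom in the image of an open
element has a compact saturated neighborhood inside it. -/
theorem atomSpace_locallyCompact_sober {M : Type*} [CompleteBooleanAlgebra M]
    (T : MTAlg M) (hsob : T.Sober) (hlc : T.LocallyCompact) :
    (@T0Space (AtomSpace M) T.atTop ∧ @QuasiSober (AtomSpace M) T.atTop) ∧
    ∀ u : M, T.IsOpenElem u → ∀ x : AtomSpace M, x ∈ eta u →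
      ∃ v : M, ∃ K : Set (AtomSpace M),
        T.IsOpenElem v ∧
        @IsCompact (AtomSpace M) T.atTop K ∧
        (∃ U : Set (Set (AtomSpace M)),
          (∀ w ∈ U, @IsOpen (AtomSpace M) T.atTop w) ∧ K = ⋂₀ U) ∧
        x ∈ eta v ∧ eta v ⊆ K ∧ K ⊆ eta u := by
  refine ⟨⟨hsob.1.t0Space_atTop, hsob.quasiSober_atTop⟩, fun u hu x hx => ?_⟩
  have hxu : x.1 ≤ sSup {v : M | T.IsOpenElem v ∧ T.Triangle v u} := hlc u hu ▸ hx
  obtain ⟨v, ⟨hv, k, hk, hvk, hku⟩, hxv⟩ := x.2.le_sSup.1 hxu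
  refine ⟨v, _, hv, hk.isCompact_sInter_eta hsob, ⟨_, ?_, rfl⟩, hxv, ?_, ?_⟩
  · rintro _ ⟨w, hw, -, rfl⟩
    exact MTAlg.isOpen_eta hw
  · rintro y hy _ ⟨w, -, hkw, rfl⟩
    exact le_trans hy (hvk.trans hkw)
  · exact Set.sInter_subset_of_mem ⟨u, hu, hku, rfl⟩
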